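/- Suppose det(W) ≠ 0, rank₂(W) = ⌈n/2⌉, and the Smith normal form of W is diag(1, …, 1, 2^{l₁}, 2^{l₂}, …, 2^{l_{t−1}}, 2^{l_t} b), i.e., there exist unimodular integer matrices U, V, positive integers l₁, …, l_t with t = ⌊n/2⌋, and an odd square-free integer b realizing this diagonal form with ⌈n/2⌉ leading ones. Let W₁ be the n×n integer matrix with columns A^{2j} e for j = 0, 1, …, n−1, and assume every entry of Wᵀ W₁ is even and every vector x ∈ 𝔽₂ⁿ with ((Wᵀ W₁)/2 reduced mod 2) · x = 0 satisfies (W reduced mod 2) · x = 0. Then G is determined by its generalized spectrum: for every n×n integer matrix B that is symmetric, has all diagonal entries 0 and every entry 0 or 1, if A and B have the same characteristic polynomial and J − I − A and J − I − B have the same characteristic polynomial (J the all-one matrix), then there exists a permutation matrix P with Pᵀ A P = B. -/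

import Mathlib

open Matrix

theorem charpoly_comp_neg_X_sub_one {n R : Type*} [Fintype n] [DecidableEq n] [CommRing R]
    (K : Matrix n n R) :
    K.charpoly.comp (-Polynomial.X - 1) = (-1) ^ Fintype.card n * (-1 - K).charpoly := by
  rw [← Polynomial.coe_compRingHom_apply, Matrix.charpoly, Matrix.charpoly, RingHom.map_det,
    ← Matrix.det_neg]
  congr 1
  ext1 i j
  by_cases h : i = j
  · subst h
    simp
    ring
  · simp [h]

open PowerSeries in
theorem charpolyRev_coe {n R : Type*} [Fintype n] [DecidableEq n] [CommRing R]
    (A : Matrix n n R) :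
    (A.charpolyRev : R⟦X⟧) = det (1 - (X : R⟦X⟧) • A.map (C : R →+* R⟦X⟧)) := by
  rw [← Polynomial.coeToPowerSeries.ringHom_apply, Matrix.charpolyRev, RingHom.map_det]
  congr 1
  ext1 i j
  by_cases h : i = j
  · subst h
    simp [mul_comm (C _) X]
  · simp [h, mul_comm (C _) X]

open PowerSeries in
theorem one_sub_X_smul_mul_geom {n R : Type*} [Fintype n] [DecidableEq n] [CommRing R]
    (A : Matrix n n R) :
    (1 - (X : R⟦X⟧) • A.map (C : R →+* R⟦X⟧)) *
      (Matrix.of fun i j => PowerSeries.mk fun k => (A ^ k) i j) = 1 := by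
  ext i j k
  rw [Matrix.sub_mul, Matrix.one_mul, Matrix.smul_mul]
  cases k with
  | zero =>
    by_cases h : i = j
    · subst h; simp
    · simp [h]
  | succ k =>
    have h1 : coeff (k + 1) ((1 : Matrix n n R⟦X⟧) i j) = 0 := by
      by_cases h : i = j
      · rw [h, Matrix.one_apply_eq, coeff_one, if_neg k.succ_ne_zero]
      · rw [Matrix.one_apply_ne h, map_zero]
    rw [h1, Matrix.sub_apply, map_sub, Matrix.smul_apply, smul_eq_mul, coeff_succ_X_mul]
    simp [Matrix.mul_apply, coeff_C_mul, pow_succ']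

open PowerSeries in
theorem charpolyRev_sub_ones {n R : Type*} [Fintype n] [DecidableEq n] [CommRing R]
    (A : Matrix n n R) :
    ((A - Matrix.of fun _ _ => 1).charpolyRev : R⟦X⟧) =
      (A.charpolyRev : R⟦X⟧) *
        (1 + X * PowerSeries.mk fun k => (1 : n → R) ⬝ᵥ (A ^ k *ᵥ 1)) := by
  rw [charpolyRev_coe, charpolyRev_coe]
  have h := one_sub_X_smul_mul_geom A
  set G : Matrix n n R⟦X⟧ := Matrix.of fun i j => PowerSeries.mk fun k => (A ^ k) i j with hG
  set T : Matrix n n R⟦X⟧ := 1 - (X : R⟦X⟧) • A.map (C : R →+* R⟦X⟧) with hT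
  have h2 : 1 - (X : R⟦X⟧) • (A - Matrix.of fun _ _ => 1).map (C : R →+* R⟦X⟧) =
      T * (1 + vecMulVec (G *ᵥ 1) (fun _ => X)) := by
    rw [Matrix.mul_add, Matrix.mul_one, mul_vecMulVec, mulVec_mulVec, h, one_mulVec, hT]
    ext1 i j
    simp [mul_sub]
    ring
  rw [h2, det_mul, vecMulVec_eq Unit, det_one_add_replicateCol_mul_replicateRow]
  congr 2
  ext k
  simp only [dotProduct, ← Finset.mul_sum, mulVec, hG, of_apply]
  congr 2
  ext k
  simp [map_sum]

theorem walk_count_eq {n R : Type*} [Fintype n] [DecidableEq n] [CommRing R] [IsDomain R]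
    {A B : Matrix n n R} (h : A.charpoly = B.charpoly)
    (h' : ((Matrix.of fun _ _ => (1 : R)) - 1 - A).charpoly
        = ((Matrix.of fun _ _ => (1 : R)) - 1 - B).charpoly) (k : ℕ) :
    (1 : n → R) ⬝ᵥ (A ^ k *ᵥ 1) = 1 ⬝ᵥ (B ^ k *ᵥ 1) := by
  have key : (A - Matrix.of fun _ _ => 1).charpoly = (B - Matrix.of fun _ _ => 1).charpoly := by
    have h1 := congrArg (fun p => Polynomial.comp p (-Polynomial.X - 1)) h'
    simp only [charpoly_comp_neg_X_sub_one] at h1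
    have h2 := mul_left_cancel₀ (pow_ne_zero _ (by simp)) h1
    convert h2 using 2 <;> abel
  have hrev : A.charpolyRev = B.charpolyRev := by
    rw [← reverse_charpoly, ← reverse_charpoly, h]
  have hrev' := charpolyRev_sub_ones A
  rw [← reverse_charpoly, key, reverse_charpoly, charpolyRev_sub_ones B, hrev] at hrev'
  have hne : (B.charpolyRev : PowerSeries R) ≠ 0 := by
    intro h0
    have := congrArg (PowerSeries.coeff 0) h0
    rw [Polynomial.coeff_coe, Polynomial.coeff_zero_eq_eval_zero, eval_charpolyRev] at this
    simp at this
  have h3 := mul_left_cancel₀ PowerSeries.X_ne_zero (add_left_cancel (mul_left_cancel₀ hne hrev'))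
  have h4 := congrArg (PowerSeries.coeff k) h3
  simpa using h4.symm

/-- The matrix with columns `A ^ j *ᵥ 1`, `j < n`. -/
def walkMatrix {R : Type*} [CommRing R] {n : ℕ} (A : Matrix (Fin n) (Fin n) R) :
    Matrix (Fin n) (Fin n) R :=
  Matrix.of fun i j => (A ^ (j : ℕ) *ᵥ 1) i

section Walk

variable {R : Type*} [CommRing R] {n : ℕ} {A B M : Matrix (Fin n) (Fin n) R}

theorem walkMatrix_transpose_mulVec_apply (hA : Aᵀ = A) (x : Fin n → R) (i : Fin n) :
    ((walkMatrix A)ᵀ *ᵥ x) i = 1 ⬝ᵥ (A ^ (i : ℕ) *ᵥ x) := by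
  rw [dotProduct_mulVec, ← mulVec_transpose, transpose_pow, hA]
  rfl

theorem walkMatrix_gram (hA : Aᵀ = A) (k : ℕ) :
    (walkMatrix A)ᵀ * A ^ k * walkMatrix A =
      Matrix.of fun i j : Fin n => 1 ⬝ᵥ (A ^ ((i : ℕ) + k + j) *ᵥ 1) := by
  ext i j
  have h : ∀ i, (A ^ k * walkMatrix A) i j = (A ^ (k + j) *ᵥ 1) i := by
    intro i
    rw [pow_add, ← mulVec_mulVec]
    rfl
  have := walkMatrix_transpose_mulVec_apply hA (A ^ (k + (j : ℕ)) *ᵥ 1) i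
  rw [mulVec_mulVec _ (A ^ (i : ℕ)), ← pow_add, ← add_assoc] at this
  rw [of_apply, ← this, Matrix.mul_assoc, Matrix.mul_apply]
  simp only [h]
  rfl

theorem one_vecMul_pow_walkMatrix (k : ℕ) :
    (1 ᵥ* A ^ k) ᵥ* walkMatrix A = fun j : Fin n => 1 ⬝ᵥ (A ^ (k + j) *ᵥ 1) := by
  ext j
  rw [pow_add, ← mulVec_mulVec, dotProduct_mulVec]
  rfl

theorem matrix_mul_right_cancel [IsDomain R] (hdet : M.det ≠ 0) (h : A * M = B * M) : A = B := by
  have h1 := congrArg (· * M.adjugate) h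
  simp only [Matrix.mul_assoc, mul_adjugate, Matrix.mul_smul, Matrix.mul_one] at h1
  exact smul_right_injective _ hdet h1

variable {l : R}

theorem transpose_mul_pow_mul_of_mul_walkMatrix_eq [IsDomain R] (hA : Aᵀ = A) (hB : Bᵀ = B)
    (hAB : ∀ k, (1 : Fin n → R) ⬝ᵥ (A ^ k *ᵥ 1) = 1 ⬝ᵥ (B ^ k *ᵥ 1))
    (hdet : (walkMatrix B).det ≠ 0) (hM : M * walkMatrix B = l • walkMatrix A) (k : ℕ) :
    Mᵀ * A ^ k * M = l ^ 2 • B ^ k := by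
  have h1 : (walkMatrix B)ᵀ * (Mᵀ * A ^ k * M) * walkMatrix B =
      (walkMatrix B)ᵀ * (l ^ 2 • B ^ k) * walkMatrix B := by
    calc _ = (M * walkMatrix B)ᵀ * A ^ k * (M * walkMatrix B) := by
          simp only [transpose_mul, Matrix.mul_assoc]
      _ = l ^ 2 • ((walkMatrix A)ᵀ * A ^ k * walkMatrix A) := by
          simp only [hM, transpose_smul, Matrix.smul_mul, Matrix.mul_smul, smul_smul, sq]
      _ = l ^ 2 • ((walkMatrix B)ᵀ * B ^ k * walkMatrix B) := by
          simp only [walkMatrix_gram hA, walkMatrix_gram hB, hAB]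
      _ = _ := by simp only [Matrix.smul_mul, Matrix.mul_smul]
  have h2 := congrArg Matrix.transpose (matrix_mul_right_cancel hdet h1)
  rw [transpose_mul _ (Mᵀ * A ^ k * M), transpose_mul _ (l ^ 2 • B ^ k),
    transpose_transpose] at h2
  exact transpose_injective (matrix_mul_right_cancel hdet h2)

theorem one_vecMul_pow_mul_of_mul_walkMatrix_eq [IsDomain R]
    (hAB : ∀ k, (1 : Fin n → R) ⬝ᵥ (A ^ k *ᵥ 1) = 1 ⬝ᵥ (B ^ k *ᵥ 1))
    (hdet : (walkMatrix B).det ≠ 0) (hM : M * walkMatrix B = l • walkMatrix A) (k : ℕ) :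
    1 ᵥ* (A ^ k * M) = l • (1 ᵥ* B ^ k) := by
  have h : (1 ᵥ* (A ^ k * M)) ᵥ* walkMatrix B = (l • (1 ᵥ* B ^ k)) ᵥ* walkMatrix B := by
    rw [vecMul_vecMul, Matrix.mul_assoc, hM, Matrix.mul_smul, vecMul_smul, ← vecMul_vecMul,
      smul_vecMul, one_vecMul_pow_walkMatrix, one_vecMul_pow_walkMatrix]
    simp only [hAB]
  exact sub_eq_zero.mp (eq_zero_of_vecMul_eq_zero hdet (by rw [sub_vecMul, h, sub_self]))

end Walk

theorem exists_mul_walkMatrix_eq {n : ℕ} {W W' : Matrix (Fin n) (Fin n) ℤ}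
    (hp : ∀ (p : ℕ) (l : ℤ) (M : Matrix (Fin n) (Fin n) ℤ), p.Prime → (p : ℤ) ∣ l →
      M * W' = l • W → ∀ i j, (p : ℤ) ∣ M i j) (l : ℤ) (hl : l ≠ 0)
    (M : Matrix (Fin n) (Fin n) ℤ) (hM : M * W' = l • W) :
    ∃ M : Matrix (Fin n) (Fin n) ℤ, M * W' = W := by
  induction hd : l.natAbs using Nat.strong_induction_on generalizing l M with
  | _ d ih =>
  by_cases h1 : d = 1
  · rcases Int.natAbs_eq_iff.mp (hd.trans h1) with rfl | rfl
    · exact ⟨M, by simpa using hM⟩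
    · exact ⟨-M, by simp [hM]⟩
  obtain ⟨p, hpp, hpd⟩ := Nat.exists_prime_and_dvd h1
  have hpl : (p : ℤ) ∣ l := Int.natCast_dvd.mpr (hd ▸ hpd)
  choose M' hM' using hp p l M hpp hpl hM
  obtain ⟨l', rfl⟩ := hpl
  have hp0 : (p : ℤ) ≠ 0 := by exact_mod_cast hpp.ne_zero
  refine ih l'.natAbs ?_ l' (right_ne_zero_of_mul hl) (Matrix.of M') ?_ rfl
  · rw [← hd, Int.natAbs_mul, Int.natAbs_natCast]
    exact lt_mul_left (Int.natAbs_pos.mpr (right_ne_zero_of_mul hl)) hpp.one_lt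
  · have hMM : M = (p : ℤ) • Matrix.of M' := by ext i j; simp [hM']
    rw [hMM, Matrix.smul_mul, mul_smul] at hM
    exact smul_right_injective _ hp0 hM

/-- An orthogonal integer matrix fixing the all-ones vector is a permutation matrix. -/
theorem exists_eq_permMatrix {n : Type*} [Fintype n] [DecidableEq n] {M : Matrix n n ℤ}
    (hM : Mᵀ * M = 1) (h1 : M *ᵥ 1 = 1) : ∃ σ : Equiv.Perm n, M = σ.permMatrix ℤ := by
  have hM' : M * Mᵀ = 1 := mul_eq_one_comm.mp hM
  have hrow : ∀ i, ∑ j, M i j * M i j = 1 := fun i => by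
    simpa [Matrix.mul_apply] using congrFun (congrFun hM' i) i
  have hsum : ∀ i, ∑ j, M i j = 1 := fun i => by
    simpa [Matrix.mulVec, dotProduct] using congrFun h1 i
  have hnn : ∀ i j, 0 ≤ M i j * M i j - M i j := fun i j => by
    rcases le_or_gt (M i j) 0 with h | h <;> nlinarith
  have h01 : ∀ i j, M i j = 0 ∨ M i j = 1 := fun i j => by
    have := (Finset.sum_eq_zero_iff_of_nonneg (s := Finset.univ) fun j _ => hnn i j).mp
      (by rw [Finset.sum_sub_distrib, hrow, hsum, sub_self]) j (Finset.mem_univ j)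
    have h2 : M i j * (M i j - 1) = 0 := by linarith
    rcases mul_eq_zero.mp h2 with h | h
    · exact Or.inl h
    · exact Or.inr (by linarith)
  have hex : ∀ i, ∃ j, M i j = 1 := fun i => by
    by_contra! h
    have := hsum i
    rw [Finset.sum_eq_zero fun j _ => (h01 i j).resolve_right (h j)] at this
    exact zero_ne_one this
  choose f hf using hex
  have huniq : ∀ i j, j ≠ f i → M i j = 0 := fun i j hj => by
    refine (h01 i j).resolve_right fun h => ?_
    have h2 := Finset.add_le_sum (s := Finset.univ) (f := fun j => M i j * M i j)
      (fun j _ => mul_self_nonneg _) (Finset.mem_univ j) (Finset.mem_univ (f i)) hj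
    rw [hrow] at h2
    simp [h, hf] at h2
  have hinj : Function.Injective f := fun i i' h => by
    by_contra hne
    have h2 := congrFun (congrFun hM' i) i'
    rw [Matrix.one_apply_ne hne, Matrix.mul_apply, Finset.sum_eq_single (f i)] at h2
    · rw [transpose_apply, hf, h, hf] at h2
      norm_num at h2
    · intro j _ hj
      rw [huniq i j hj, zero_mul]
    · simp
  refine ⟨Equiv.ofBijective f (Finite.injective_iff_bijective.mp hinj), ?_⟩
  ext i j
  by_cases h : j = f i
  · subst h; simp [hf, PEquiv.toMatrix_apply]
  · simp [huniq i j h, PEquiv.toMatrix_apply, Ne.symm h]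


theorem dotProduct_mulVec_self_of_charTwo {n R : Type*} [Fintype n] [DecidableEq n] [CommRing R]
    [CharP R 2] {T : Matrix n n R} (hT : Tᵀ = T) (y : n → R) :
    y ⬝ᵥ (T *ᵥ y) = ∑ i, T i i * y i ^ 2 := by
  have hT' : ∀ i j, T i j = T j i := fun i j => by
    conv_lhs => rw [← hT]
    rfl
  have h : y ⬝ᵥ (T *ᵥ y) = ∑ q ∈ Finset.univ ×ˢ Finset.univ, y q.1 * (T q.1 q.2 * y q.2) := by
    simp only [dotProduct, mulVec, Finset.mul_sum, Finset.sum_product]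
  rw [h, ← Finset.diag_union_offDiag, Finset.sum_union (Finset.disjoint_diag_offDiag _),
    Finset.sum_diag]
  have h2 : ∑ q ∈ (Finset.univ : Finset n).offDiag, y q.1 * (T q.1 q.2 * y q.2) = 0 := by
    refine Finset.sum_involution (fun q _ => q.swap) ?_ ?_ ?_ ?_
    · rintro ⟨i, j⟩ -
      rw [Prod.swap_prod_mk, hT' j i, show y j * (T i j * y i) = y i * (T i j * y j) by ring,
        CharTwo.add_self_eq_zero]
    · rintro ⟨i, j⟩ hq - heq
      rw [Finset.mem_offDiag] at hq
      exact hq.2.2 (congrArg Prod.snd heq)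
    · rintro ⟨i, j⟩ hq
      simpa [eq_comm] using hq
    · simp
  rw [h2, add_zero]
  exact Finset.sum_congr rfl fun i _ => by ring

theorem ker_transpose_eq_range {m K : Type*} [Fintype m] [DecidableEq m] [Field K]
    {W : Matrix m m K} (h : Wᵀ * W = 0) (hr : Fintype.card m ≤ W.rank + W.rank) :
    LinearMap.ker Wᵀ.mulVecLin = LinearMap.range W.mulVecLin := by
  symm
  refine Submodule.eq_of_le_of_finrank_le ?_ ?_
  · rintro _ ⟨x, rfl⟩
    rw [LinearMap.mem_ker, mulVecLin_apply, mulVecLin_apply, mulVec_mulVec, h, zero_mulVec]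
  · have h1 := LinearMap.finrank_range_add_finrank_ker Wᵀ.mulVecLin
    rw [Module.finrank_fintype_fun_eq_card] at h1
    have h2 : Module.finrank K (LinearMap.range Wᵀ.mulVecLin) = W.rank := rank_transpose W
    have h3 : Module.finrank K (LinearMap.range W.mulVecLin) = W.rank := rfl
    omega

/-- A bordered singular symmetric system is solvable under the obvious orthogonality condition. -/
theorem exists_bordered_solution {n K : Type*} [Fintype n] [DecidableEq n] [Field K]
    {A : Matrix n n K} (hA : Aᵀ = A) {e u : n → K} {lam : K} (hu : u ≠ 0)
    (hAu : A *ᵥ u = lam • u) (heu : e ⬝ᵥ u = 0) (huu : u ⬝ᵥ u = 0)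
    (huniq : ∀ x, (∀ k, e ⬝ᵥ (A ^ k *ᵥ x) = 0) → ∃ c : K, x = c • u)
    (b : n → K) (hb : u ⬝ᵥ b = 0) (c : K) :
    ∃ (x : n → K) (μ : K), A *ᵥ x - lam • x - μ • u = b ∧ e ⬝ᵥ x = c := by
  let f : ((n → K) × K) →ₗ[K] ((n → K) × K) :=
    { toFun := fun q => (A *ᵥ q.1 - lam • q.1 - q.2 • u, e ⬝ᵥ q.1)
      map_add' := fun q r => by
        simp only [Prod.fst_add, Prod.snd_add, mulVec_add, dotProduct_add, smul_add, add_smul,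
          Prod.mk_add_mk]
        congr 1
        abel
      map_smul' := fun a q => by
        simp only [Prod.smul_fst, Prod.smul_snd, mulVec_smul, dotProduct_smul, Prod.smul_mk,
          RingHom.id_apply, smul_sub, smul_comm a lam, smul_assoc] }
  let g : ((n → K) × K) →ₗ[K] K :=
    { toFun := fun q => u ⬝ᵥ q.1
      map_add' := fun q r => by simp only [Prod.fst_add, dotProduct_add]
      map_smul' := fun a q => by simp only [Prod.smul_fst, dotProduct_smul, RingHom.id_apply] }
  have hle : LinearMap.range f ≤ LinearMap.ker g := by
    rintro _ ⟨⟨x, μ⟩, rfl⟩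
    change u ⬝ᵥ (A *ᵥ x - lam • x - μ • u) = 0
    have h : u ⬝ᵥ (A *ᵥ x) = lam * (u ⬝ᵥ x) := by
      rw [dotProduct_mulVec, ← mulVec_transpose, hA, hAu, smul_dotProduct, smul_eq_mul]
    rw [dotProduct_sub, dotProduct_sub, dotProduct_smul, dotProduct_smul, huu, h]
    simp
  have hker : LinearMap.ker f ≤ Submodule.span K {(u, 0)} := by
    rintro ⟨x, μ⟩ hx
    obtain ⟨h1, h2⟩ := Prod.mk.inj (LinearMap.mem_ker.mp hx)
    change A *ᵥ x - lam • x - μ • u = 0 at h1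
    change e ⬝ᵥ x = 0 at h2
    have hAx : A *ᵥ x = lam • x + μ • u := by
      rw [sub_sub, sub_eq_zero] at h1
      exact h1
    have hku : ∀ k, e ⬝ᵥ (A ^ k *ᵥ u) = 0 := fun k => by
      induction k with
      | zero => simpa using heu
      | succ k ih => rw [pow_succ, ← mulVec_mulVec, hAu, mulVec_smul, dotProduct_smul, ih, smul_zero]
    have hkx : ∀ k, e ⬝ᵥ (A ^ k *ᵥ x) = 0 := fun k => by
      induction k with
      | zero => simpa using h2
      | succ k ih =>
        rw [pow_succ, ← mulVec_mulVec, hAx, mulVec_add, mulVec_smul, mulVec_smul, dotProduct_add,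
          dotProduct_smul, dotProduct_smul, ih, hku]
        simp
    obtain ⟨c, rfl⟩ := huniq x hkx
    have hμ : μ • u = 0 := by
      rw [mulVec_smul, hAu, smul_comm, sub_self, zero_sub, neg_eq_zero] at h1
      exact h1
    rw [(smul_eq_zero.mp hμ).resolve_right hu]
    exact Submodule.mem_span_singleton.mpr ⟨c, by simp⟩
  have heq : LinearMap.range f = LinearMap.ker g := by
    refine Submodule.eq_of_le_of_finrank_le hle ?_
    have h1 := LinearMap.finrank_range_add_finrank_ker f
    have h2 := LinearMap.finrank_range_add_finrank_ker g
    have h3 := (Submodule.finrank_mono hker).trans (finrank_span_singleton (by simpa using hu)).le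
    have h4 : 0 < Module.finrank K (LinearMap.range g) := by
      rw [Module.finrank_pos_iff_exists_ne_zero]
      by_contra! h
      refine hu (dotProduct_eq_zero _ fun w => ?_)
      exact congrArg Subtype.val (h ⟨g (w, 0), LinearMap.mem_range_self g _⟩)
    omega
  have hmem : (b, c) ∈ LinearMap.range f := heq ▸ (LinearMap.mem_ker.mpr hb : (b, c) ∈ _)
  obtain ⟨⟨x, μ⟩, hx⟩ := hmem
  exact ⟨x, μ, Prod.mk.inj hx⟩

theorem exists_eq_smul_of_mul_eq_diagonal {n K : Type*} [Fintype n] [DecidableEq n] [Field K]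
    {U W V : Matrix n n K} {d : n → K} (hU : IsUnit U.det) (h : U * W * V = diagonal d) {i₀ : n}
    (hd : ∀ i, i ≠ i₀ → d i ≠ 0) {x y : n → K} (hx : Wᵀ *ᵥ x = 0) (hy : Wᵀ *ᵥ y = 0)
    (hy0 : y ≠ 0) : ∃ c : K, x = c • y := by
  have hU' : IsUnit Uᵀ.det := by rwa [det_transpose]
  have key : ∀ z, Wᵀ *ᵥ z = 0 → ∃ z', z = Uᵀ *ᵥ z' ∧ ∀ i, i ≠ i₀ → z' i = 0 := fun z hz => by
    have hz' : z = Uᵀ *ᵥ (Uᵀ⁻¹ *ᵥ z) := by rw [mulVec_mulVec, mul_nonsing_inv _ hU', one_mulVec]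
    refine ⟨_, hz', fun i hi => ?_⟩
    have h1 : diagonal d *ᵥ (Uᵀ⁻¹ *ᵥ z) = 0 := by
      rw [← diagonal_transpose, ← h, transpose_mul, transpose_mul, ← mulVec_mulVec,
        ← mulVec_mulVec, ← hz', hz, mulVec_zero]
    have h2 := congrFun h1 i
    rw [mulVec_diagonal] at h2
    exact (mul_eq_zero.mp h2).resolve_left (hd i hi)
  obtain ⟨x', rfl, hx'⟩ := key x hx
  obtain ⟨y', rfl, hy'⟩ := key y hy
  have hyi : y' i₀ ≠ 0 := fun h0 => hy0 <| by
    have : y' = 0 := funext fun i => if hi : i = i₀ then hi ▸ h0 else hy' i hi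
    rw [this, mulVec_zero]
  refine ⟨x' i₀ / y' i₀, ?_⟩
  rw [← mulVec_smul]
  congr 1
  ext i
  by_cases hi : i = i₀
  · subst hi; simp [hyi]
  · simp [hx' i hi, hy' i hi]

theorem dvd_of_mul_eq_diagonal {n : Type*} [Fintype n] [DecidableEq n]
    {U W V : Matrix n n ℤ} {d : n → ℤ} (hU : IsUnit U.det) (h : U * W * V = diagonal d)
    {p : ℕ} (hp : p.Prime) (hd : ∀ i, ¬ (p : ℤ) ^ 2 ∣ d i) {x : n → ℤ}
    (hx : ∀ i, (p : ℤ) ^ 2 ∣ (Wᵀ *ᵥ x) i) (i : n) : (p : ℤ) ∣ x i := by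
  have hU' : IsUnit Uᵀ.det := by rwa [det_transpose]
  have hx' : x = Uᵀ *ᵥ (Uᵀ⁻¹ *ᵥ x) := by rw [mulVec_mulVec, mul_nonsing_inv _ hU', one_mulVec]
  have h1 : diagonal d *ᵥ (Uᵀ⁻¹ *ᵥ x) = Vᵀ *ᵥ (Wᵀ *ᵥ x) := by
    rw [← diagonal_transpose, ← h, transpose_mul, transpose_mul, ← mulVec_mulVec,
      ← mulVec_mulVec, ← hx']
  rw [hx']
  refine Finset.dvd_sum fun j _ => dvd_mul_of_dvd_right ?_ _
  have h2 := congrFun h1 j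
  rw [mulVec_diagonal] at h2
  have h3 : (p : ℤ) ^ 2 ∣ d j * (Uᵀ⁻¹ *ᵥ x) j := by
    rw [h2]
    exact Finset.dvd_sum fun k _ => dvd_mul_of_dvd_right (hx k) _
  by_contra hn
  refine hd j (IsCoprime.dvd_of_dvd_mul_right ?_ h3)
  exact (((Nat.prime_iff_prime_int.mp hp).coprime_iff_not_dvd).mpr hn).pow_left

section Lift

variable {n : ℕ} {A : Matrix (Fin n) (Fin n) ℤ} {u : Fin n → ℤ}

theorem walkMatrix_transpose_mulVec_cast_eq_zero (hA : Aᵀ = A) {p : ℕ}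
    (hu : ∀ k, (p : ℤ) ∣ 1 ⬝ᵥ (A ^ k *ᵥ u)) :
    ((walkMatrix A).map (Int.cast : ℤ → ZMod p))ᵀ *ᵥ (fun i => (u i : ZMod p)) = 0 := by
  ext i
  have h := (ZMod.intCast_zmod_eq_zero_iff_dvd _ p).mpr
    (walkMatrix_transpose_mulVec_apply hA u i ▸ hu i)
  rw [mulVec, dotProduct, Int.cast_sum] at h
  simpa [mulVec, dotProduct] using h

theorem two_dvd_of_four_dvd_dotProduct (hA : Aᵀ = A)
    (hrank : n ≤ ((walkMatrix A).map (Int.cast : ℤ → ZMod 2)).rank +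
      ((walkMatrix A).map (Int.cast : ℤ → ZMod 2)).rank)
    {t : ℕ → ℤ}
    (ht : ∀ i j k : Fin n, 1 ⬝ᵥ (A ^ ((i : ℕ) + k + j) *ᵥ 1) = 2 * t (i + k + j))
    (hker : ∀ y : Fin n → ZMod 2, (∀ k : Fin n, ∑ i : Fin n, (t (i + k + i) : ZMod 2) * y i = 0) →
      (walkMatrix A).map (Int.cast : ℤ → ZMod 2) *ᵥ y = 0)
    (hu : ∀ k, ((2 : ℕ) : ℤ) ∣ 1 ⬝ᵥ (A ^ k *ᵥ u)) (hu4 : ∀ k, 4 ∣ u ⬝ᵥ (A ^ k *ᵥ u)) (i : Fin n) :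
    2 ∣ u i := by
  have hgram : ∀ k : Fin n, (walkMatrix A)ᵀ * A ^ (k : ℕ) * walkMatrix A =
      2 • Matrix.of fun i j : Fin n => t (i + k + j) := fun k => by
    rw [walkMatrix_gram hA]
    ext i j
    simp [ht i j k]
  have hWW : ((walkMatrix A).map (Int.cast : ℤ → ZMod 2))ᵀ *
      (walkMatrix A).map (Int.cast : ℤ → ZMod 2) = 0 := by
    have h := hgram ⟨0, i.pos⟩
    rw [pow_zero, Matrix.mul_one] at h
    have h2 := congrArg (fun M => M.map (Int.castRingHom (ZMod 2))) h
    simp only [Matrix.map_mul] at h2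
    refine h2.trans ?_
    ext i j
    simp only [map_apply, Matrix.smul_apply, map_nsmul, Matrix.zero_apply]
    exact CharTwo.two_nsmul _
  have hmem := walkMatrix_transpose_mulVec_cast_eq_zero hA hu
  rw [← mulVecLin_apply, ← LinearMap.mem_ker,
    ker_transpose_eq_range hWW (by rwa [Fintype.card_fin])] at hmem
  obtain ⟨y, hy⟩ := hmem
  rw [mulVecLin_apply] at hy
  let Y : Fin n → ℤ := fun i => (y i).val
  have hYy : ∀ i, (Y i : ZMod 2) = y i := fun i => by simp [Y]
  have hdiv : ∀ i, (2 : ℤ) ∣ u i - (walkMatrix A *ᵥ Y) i := fun i => by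
    have h := congrFun hy i
    refine (ZMod.intCast_zmod_eq_zero_iff_dvd _ 2).mp ?_
    rw [Int.cast_sub, ← h, sub_eq_zero, mulVec, mulVec, dotProduct, dotProduct, Int.cast_sum]
    simp [hYy]
  choose b hb using hdiv
  have hub : u = walkMatrix A *ᵥ Y + (2 : ℤ) • b := by
    ext i
    simp [← hb]
  have hquad : ∀ k : Fin n, (2 : ℤ) ∣ Y ⬝ᵥ ((Matrix.of fun i j : Fin n => t (i + k + j)) *ᵥ Y) := by
    intro k
    have h4 := hu4 k
    have hsymm : b ⬝ᵥ (A ^ (k : ℕ) *ᵥ (walkMatrix A *ᵥ Y)) =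
        (walkMatrix A *ᵥ Y) ⬝ᵥ (A ^ (k : ℕ) *ᵥ b) := by
      rw [dotProduct_comm, dotProduct_mulVec (walkMatrix A *ᵥ Y), ← mulVec_transpose,
        transpose_pow, hA]
    have hWY : (walkMatrix A *ᵥ Y) ⬝ᵥ (A ^ (k : ℕ) *ᵥ (walkMatrix A *ᵥ Y)) =
        2 * (Y ⬝ᵥ ((Matrix.of fun i j : Fin n => t (i + k + j)) *ᵥ Y)) := by
      rw [← vecMul_transpose, ← dotProduct_mulVec, vecMul_transpose, mulVec_mulVec, mulVec_mulVec,
        hgram, smul_mulVec, dotProduct_smul, nsmul_eq_mul, Nat.cast_ofNat]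
    rw [hub, mulVec_add, add_dotProduct, dotProduct_add, dotProduct_add, mulVec_smul,
      smul_dotProduct, smul_dotProduct, dotProduct_smul, dotProduct_smul, hsymm, hWY] at h4
    simp only [smul_eq_mul] at h4
    omega
  have hy0 : (walkMatrix A).map (Int.cast : ℤ → ZMod 2) *ᵥ y = 0 := by
    refine hker y fun k => ?_
    have h := (ZMod.intCast_zmod_eq_zero_iff_dvd _ 2).mpr (hquad k)
    have hT : (Matrix.of fun i j : Fin n => (t (i + k + j) : ZMod 2))ᵀ =
        Matrix.of fun i j : Fin n => (t (i + k + j) : ZMod 2) := by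
      ext i j
      simp only [transpose_apply, of_apply]
      congr 2
      ring
    have h2 := dotProduct_mulVec_self_of_charTwo hT y
    have hsq : ∀ a : ZMod 2, a ^ 2 = a := by decide
    simp only [of_apply, hsq] at h2
    rw [← h2, ← h]
    simp [dotProduct, mulVec, hYy]
  rw [hy0] at hy
  exact (ZMod.intCast_zmod_eq_zero_iff_dvd _ 2).mp (congrFun hy i).symm

theorem dvd_of_sq_dvd_dotProduct (hA : Aᵀ = A) {p : ℕ} (hp : p.Prime)
    (hker : ∀ x y : Fin n → ZMod p,
      ((walkMatrix A).map (Int.cast : ℤ → ZMod p))ᵀ *ᵥ x = 0 →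
      ((walkMatrix A).map (Int.cast : ℤ → ZMod p))ᵀ *ᵥ y = 0 → y ≠ 0 → ∃ c : ZMod p, x = c • y)
    (hsq : ∀ x : Fin n → ℤ, (∀ i, (p : ℤ) ^ 2 ∣ ((walkMatrix A)ᵀ *ᵥ x) i) → ∀ i, (p : ℤ) ∣ x i)
    (hu : ∀ k, (p : ℤ) ∣ 1 ⬝ᵥ (A ^ k *ᵥ u)) (huu : (p : ℤ) ^ 2 ∣ u ⬝ᵥ u)
    (huA : (p : ℤ) ^ 2 ∣ u ⬝ᵥ (A *ᵥ u)) (i : Fin n) : (p : ℤ) ∣ u i := by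
  have := Fact.mk hp
  have hp0 : (p : ℤ) ≠ 0 := by exact_mod_cast hp.ne_zero
  have hcast : ∀ (M : Matrix (Fin n) (Fin n) ℤ) (v : Fin n → ℤ),
      (fun i => ((M *ᵥ v) i : ZMod p)) =
        M.map (Int.cast : ℤ → ZMod p) *ᵥ fun i => (v i : ZMod p) := fun M v => by
    ext i
    simp [mulVec, dotProduct]
  set ub : Fin n → ZMod p := fun i => (u i : ZMod p) with hub
  set Ab : Matrix (Fin n) (Fin n) (ZMod p) := A.map (Int.cast : ℤ → ZMod p) with hAb
  have hAbs : Abᵀ = Ab := by rw [hAb, ← transpose_map, hA]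
  have hWb : (walkMatrix A).map (Int.cast : ℤ → ZMod p) = walkMatrix Ab := by
    ext i j
    have h1 : Ab ^ (j : ℕ) = (A ^ (j : ℕ)).map (Int.cast : ℤ → ZMod p) :=
      (Matrix.map_pow A (Int.castRingHom (ZMod p)) (j : ℕ)).symm
    have h2 := congrFun (hcast (A ^ (j : ℕ)) 1) i
    simp only [walkMatrix, map_apply, of_apply, h1]
    rw [h2]
    congr 2
    ext
    simp
  by_contra hui
  have hu0 : ub ≠ 0 := fun h0 => hui ((ZMod.intCast_zmod_eq_zero_iff_dvd _ p).mp (congrFun h0 i))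
  have hWu := walkMatrix_transpose_mulVec_cast_eq_zero hA hu
  have hWAu := walkMatrix_transpose_mulVec_cast_eq_zero (u := A *ᵥ u) hA fun k => by
    rw [mulVec_mulVec, ← pow_succ]
    exact hu (k + 1)
  obtain ⟨lamb, hlamb⟩ := hker _ _ hWAu hWu hu0
  rw [hcast] at hlamb
  obtain ⟨lam, rfl⟩ := ZMod.intCast_surjective lamb
  have hAu : ∀ i, (p : ℤ) ∣ (A *ᵥ u) i - lam * u i := fun i => by
    refine (ZMod.intCast_zmod_eq_zero_iff_dvd _ p).mp ?_
    have h := (congrFun (hcast A u) i).trans (congrFun hlamb i)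
    beta_reduce at h
    rw [Int.cast_sub, h]
    simp
  choose b hb using hAu
  have hAub : A *ᵥ u = lam • u + (p : ℤ) • b := by
    ext i
    simp [← hb]
  obtain ⟨c, hc⟩ := hu 0
  rw [pow_zero, one_mulVec] at hc
  have hdot : ∀ v w : Fin n → ℤ,
      (fun i => (v i : ZMod p)) ⬝ᵥ (fun i => (w i : ZMod p)) = ((v ⬝ᵥ w : ℤ) : ZMod p) :=
    fun v w => by simp [dotProduct]
  have hone : (1 : Fin n → ZMod p) = fun i => (((1 : Fin n → ℤ) i : ℤ) : ZMod p) := by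
    ext
    simp
  have hub1 : (1 : Fin n → ZMod p) ⬝ᵥ ub = 0 := by
    rw [hone, hdot, hc]
    simp
  have hubub : ub ⬝ᵥ ub = 0 := by
    rw [hdot]
    exact (ZMod.intCast_zmod_eq_zero_iff_dvd _ p).mpr ((dvd_pow_self _ two_ne_zero).trans huu)
  have hubb : ub ⬝ᵥ (fun i => (-b i : ZMod p)) = 0 := by
    have h1 : (p : ℤ) ^ 2 ∣ p * (u ⬝ᵥ b) := by
      rw [hAub, dotProduct_add, dotProduct_smul, dotProduct_smul, smul_eq_mul, smul_eq_mul] at huA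
      exact (dvd_add_right (huu.mul_left lam)).mp huA
    rw [sq] at h1
    have h2 := (ZMod.intCast_zmod_eq_zero_iff_dvd _ p).mpr (Int.dvd_of_mul_dvd_mul_left hp0 h1)
    rw [show (fun i => (-b i : ZMod p)) = -fun i => (b i : ZMod p) from rfl, dotProduct_neg,
      hdot, h2, neg_zero]
  obtain ⟨xb, μb, hx1, hx2⟩ := exists_bordered_solution hAbs hu0 hlamb hub1 hubub
    (fun x hx => hker x ub
      (by rw [hWb]; ext i; rw [walkMatrix_transpose_mulVec_apply hAbs]; exact hx i) hWu hu0)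
    _ hubb (-(c : ZMod p))
  choose x hx using fun i => ZMod.intCast_surjective (xb i)
  obtain ⟨μ, rfl⟩ := ZMod.intCast_surjective μb
  obtain rfl : (fun i => (x i : ZMod p)) = xb := funext hx
  have hdx : ∀ i, (p : ℤ) ∣ (A *ᵥ x) i - lam * x i - μ * u i + b i := fun i => by
    refine (ZMod.intCast_zmod_eq_zero_iff_dvd _ p).mp ?_
    have := congrFun hx1 i
    rw [← hcast] at this
    simp only [Pi.sub_apply, Pi.smul_apply, smul_eq_mul, hub] at this
    push_cast
    rw [this, neg_add_cancel]
  have hdc : (p : ℤ) ∣ 1 ⬝ᵥ x + c := by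
    refine (ZMod.intCast_zmod_eq_zero_iff_dvd _ p).mp ?_
    rw [hone, hdot] at hx2
    rw [Int.cast_add, hx2, neg_add_cancel]
  choose r hr using hdx
  have hAx : A *ᵥ x = lam • x + μ • u - b + (p : ℤ) • r := by
    ext i
    simp [← hr]
  have hAv : A *ᵥ (u + (p : ℤ) • x) =
      (lam + p * μ) • (u + (p : ℤ) • x) + (p : ℤ) ^ 2 • (r - μ • x) := by
    rw [mulVec_add, mulVec_smul, hAub, hAx]
    module
  have hv : ∀ k, (p : ℤ) ^ 2 ∣ 1 ⬝ᵥ (A ^ k *ᵥ (u + (p : ℤ) • x)) := fun k => by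
    induction k with
    | zero =>
      rw [pow_zero, one_mulVec, dotProduct_add, dotProduct_smul, hc, smul_eq_mul, ← mul_add, sq,
        add_comm c]
      exact mul_dvd_mul_left _ hdc
    | succ k ih =>
      rw [pow_succ A, ← mulVec_mulVec, hAv, mulVec_add, mulVec_smul, mulVec_smul, dotProduct_add,
        dotProduct_smul, dotProduct_smul, smul_eq_mul, smul_eq_mul]
      exact dvd_add (ih.mul_left _) (dvd_mul_right _ _)
  have h := hsq (u + (p : ℤ) • x)
    (fun i => by rw [walkMatrix_transpose_mulVec_apply hA]; exact hv i) i
  rw [Pi.add_apply, Pi.smul_apply, smul_eq_mul] at h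
  exact hui ((dvd_add_left (dvd_mul_right _ _)).mp h)

end Lift

theorem exists_permMatrix_conj_eq_of_walkMatrix {n : ℕ} {A B : Matrix (Fin n) (Fin n) ℤ}
    (hA : Aᵀ = A) (hB : Bᵀ = B)
    (hAB : ∀ k, (1 : Fin n → ℤ) ⬝ᵥ (A ^ k *ᵥ 1) = 1 ⬝ᵥ (B ^ k *ᵥ 1))
    (hdet : (walkMatrix A).det ≠ 0)
    (hp : ∀ (p : ℕ) (u : Fin n → ℤ), p.Prime → (∀ k, (p : ℤ) ∣ 1 ⬝ᵥ (A ^ k *ᵥ u)) →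
      (∀ k, (p : ℤ) ^ 2 ∣ u ⬝ᵥ (A ^ k *ᵥ u)) → ∀ i, (p : ℤ) ∣ u i) :
    ∃ σ : Equiv.Perm (Fin n), (σ.permMatrix ℤ)ᵀ * A * σ.permMatrix ℤ = B := by
  have hdetB : (walkMatrix B).det ≠ 0 := by
    have h : (walkMatrix A)ᵀ * A ^ 0 * walkMatrix A = (walkMatrix B)ᵀ * B ^ 0 * walkMatrix B := by
      simp only [walkMatrix_gram hA, walkMatrix_gram hB, hAB]
    have h2 := congrArg Matrix.det h
    simp only [pow_zero, Matrix.mul_one, det_mul, det_transpose] at h2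
    intro h0
    rw [h0, mul_zero] at h2
    exact hdet (mul_self_eq_zero.mp h2)
  obtain ⟨M, hM⟩ := exists_mul_walkMatrix_eq (W := walkMatrix A) (W' := walkMatrix B)
    (fun p l M hpp hpl hM i j => by
      have h1 := one_vecMul_pow_mul_of_mul_walkMatrix_eq hAB hdetB hM
      have h2 := transpose_mul_pow_mul_of_mul_walkMatrix_eq hA hB hAB hdetB hM
      have hu : ∀ k, (fun i => (A ^ k * M) i j) = A ^ k *ᵥ fun i => M i j := fun k => rfl
      refine hp p (fun i => M i j) hpp (fun k => ?_) (fun k => ?_) i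
      · have h3 : 1 ⬝ᵥ (A ^ k *ᵥ fun i => M i j) = l * (1 ᵥ* B ^ k) j := congrFun (h1 k) j
        rw [h3]
        exact hpl.mul_right _
      · have h3 : (fun i => M i j) ⬝ᵥ (A ^ k *ᵥ fun i => M i j) = l ^ 2 * (B ^ k) j j := by
          rw [← smul_eq_mul, ← Matrix.smul_apply, ← h2, Matrix.mul_assoc, ← hu]
          rfl
        rw [h3]
        exact (pow_dvd_pow_of_dvd hpl 2).mul_right _)
    _ hdetB (walkMatrix A * (walkMatrix B).adjugate)
    (by rw [Matrix.mul_assoc, adjugate_mul, Matrix.mul_smul, Matrix.mul_one])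
  rw [← one_smul ℤ (walkMatrix A)] at hM
  have h1 := one_vecMul_pow_mul_of_mul_walkMatrix_eq hAB hdetB hM 0
  have h2 := transpose_mul_pow_mul_of_mul_walkMatrix_eq hA hB hAB hdetB hM
  have h3 := h2 0
  simp only [pow_zero, Matrix.one_mul, Matrix.mul_one, one_pow, one_smul, vecMul_one] at h1 h3
  obtain ⟨σ, rfl⟩ := exists_eq_permMatrix h3 (by
    conv_lhs => rw [← h1, ← mulVec_transpose, mulVec_mulVec, mul_eq_one_comm.mp h3, one_mulVec])
  exact ⟨σ, by simpa using h2 1⟩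

/-- If `rank₂(W) = ⌈n/2⌉`, the SNF of `W` is
`diag(1,…,1,2^{l₁},…,2^{l_t}b)` with `b` odd square-free, `WᵀW₁` has even entries
and the kernel condition holds, then `G` is determined by its generalized
spectrum. -/
theorem stmt_17 (n : ℕ) (hn : 0 < n)
    (A : Matrix (Fin n) (Fin n) ℤ)
    (hA_symm : Aᵀ = A)
    (hA_diag : ∀ i, A i i = 0)
    (hA_01 : ∀ i j, A i j = 0 ∨ A i j = 1)
    (W : Matrix (Fin n) (Fin n) ℤ)
    (hW : W = Matrix.of fun (i j : Fin n) => (A ^ (j : ℕ)).mulVec (fun _ => (1 : ℤ)) i)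
    (hdet : W.det ≠ 0)
    (hrank : (W.map (Int.cast : ℤ → ZMod 2)).rank = (n + 1) / 2)
    (hSNF : ∃ (U V : Matrix (Fin n) (Fin n) ℤ) (l : Fin (n / 2) → ℕ) (b : ℤ),
      (U.det = 1 ∨ U.det = -1) ∧ (V.det = 1 ∨ V.det = -1) ∧
      (∀ i, 0 < l i) ∧ Odd b ∧ Squarefree b ∧
      U * W * V = Matrix.diagonal (fun i : Fin n =>
        if h : (i : ℕ) < (n + 1) / 2 then (1 : ℤ)
        else 2 ^ (l ⟨(i : ℕ) - (n + 1) / 2, by have := i.isLt; omega⟩) *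
          (if (i : ℕ) = n - 1 then b else 1)))
    (W₁ : Matrix (Fin n) (Fin n) ℤ)
    (hW₁ : W₁ = Matrix.of fun (i j : Fin n) =>
      (A ^ (2 * (j : ℕ))).mulVec (fun _ => (1 : ℤ)) i)
    (hEven : ∀ i j, Even ((Wᵀ * W₁) i j))
    (hker : ∀ x : Fin n → ZMod 2,
      ((Matrix.of fun (i j : Fin n) => (Wᵀ * W₁) i j / 2).map
        (Int.cast : ℤ → ZMod 2)).mulVec x = 0 →
      (W.map (Int.cast : ℤ → ZMod 2)).mulVec x = 0) :
    ∀ B : Matrix (Fin n) (Fin n) ℤ, Bᵀ = B → (∀ i, B i i = 0) →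
      (∀ i j, B i j = 0 ∨ B i j = 1) →
      A.charpoly = B.charpoly →
      ((Matrix.of fun _ _ => (1 : ℤ)) - 1 - A).charpoly
        = ((Matrix.of fun _ _ => (1 : ℤ)) - 1 - B).charpoly →
      ∃ σ : Equiv.Perm (Fin n), (σ.permMatrix ℤ)ᵀ * A * σ.permMatrix ℤ = B := by
  intro B hB _ _ hchar hchar'
  have hAB := walk_count_eq hchar hchar'
  obtain rfl : W = walkMatrix A := hW
  have hent : ∀ i j : Fin n,
      ((walkMatrix A)ᵀ * W₁) i j = 1 ⬝ᵥ (A ^ ((i : ℕ) + 2 * j) *ᵥ 1) := fun i j => by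
    rw [pow_add, ← mulVec_mulVec, ← walkMatrix_transpose_mulVec_apply hA_symm, hW₁]
    rfl
  have hn2 : Even n := by
    have h := hEven ⟨0, hn⟩ ⟨0, hn⟩
    rw [hent] at h
    simpa using h
  have hhalf : (n + 1) / 2 + (n + 1) / 2 = n := by
    obtain ⟨m, rfl⟩ := hn2
    omega
  have ht : ∀ i j k : Fin n, 1 ⬝ᵥ (A ^ ((i : ℕ) + k + j) *ᵥ 1) =
      2 * (1 ⬝ᵥ (A ^ ((i : ℕ) + k + j) *ᵥ 1) / 2) := fun i j k => by
    obtain ⟨a, b, hab⟩ : ∃ a b : Fin n, (i : ℕ) + k + j = a + 2 * b :=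
      ⟨⟨(i : ℕ) + k + j - 2 * min (((i : ℕ) + k + j) / 2) (n - 1), by omega⟩,
        ⟨min (((i : ℕ) + k + j) / 2) (n - 1), by omega⟩, by simp only; omega⟩
    rw [hab, ← hent]
    have := hEven a b
    rw [even_iff_two_dvd] at this
    omega
  refine exists_permMatrix_conj_eq_of_walkMatrix hA_symm hB hAB hdet fun p u hp hu hu2 => ?_
  rcases hp.eq_two_or_odd' with rfl | hodd
  · refine two_dvd_of_four_dvd_dotProduct hA_symm (by rw [hrank, hhalf])
      (t := fun m => 1 ⬝ᵥ (A ^ m *ᵥ 1) / 2) ht (fun y hy => hker y ?_) hu hu2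
    ext k
    rw [Pi.zero_apply, ← hy k, mulVec, dotProduct]
    refine Finset.sum_congr rfl fun i _ => ?_
    rw [map_apply, of_apply, hent, show (k : ℕ) + 2 * i = i + k + i by ring]
  · have hpp := Nat.prime_iff_prime_int.mp hp
    have := Fact.mk hp
    obtain ⟨U, V, l, b, hU, -, -, -, hb, hUWV⟩ := hSNF
    have hUu : IsUnit U.det := Int.isUnit_iff.mpr hU
    have hp2 : ∀ m : ℕ, ¬ (p : ℤ) ∣ 2 ^ m := fun m h => by
      have h2 : p ∣ 2 := by exact_mod_cast hpp.dvd_of_dvd_pow h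
      rw [(Nat.prime_dvd_prime_iff_eq hp Nat.prime_two).mp h2] at hodd
      exact absurd hodd (by decide)
    generalize hd : (fun i : Fin n => _) = d at hUWV
    have hd1 : ∀ i : Fin n, i ≠ ⟨n - 1, by omega⟩ → ¬ (p : ℤ) ∣ d i := fun i hi => by
      have hi' : (i : ℕ) ≠ n - 1 := fun h => hi (Fin.ext h)
      simp only [← hd, if_neg hi', mul_one]
      split_ifs
      · exact hpp.not_dvd_one
      · exact hp2 _
    have hd2 : ∀ i, ¬ (p : ℤ) ^ 2 ∣ d i := fun i h => by
      by_cases hi : i = ⟨n - 1, by omega⟩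
      · simp only [← hd, hi, if_pos] at h
        rw [dif_neg (by omega)] at h
        have hcop : ∀ m : ℕ, IsCoprime ((p : ℤ) ^ 2) (2 ^ m) := fun m =>
          ((hpp.coprime_iff_not_dvd).mpr (hp2 _)).pow_left
        have h3 := (hcop _).dvd_of_dvd_mul_left h
        rw [sq] at h3
        exact hpp.not_isUnit (hb _ h3)
      · exact hd1 i hi ((dvd_pow_self _ two_ne_zero).trans h)
    refine dvd_of_sq_dvd_dotProduct hA_symm hp (fun x y hx hy hy0 => ?_)
      (fun x hx => dvd_of_mul_eq_diagonal hUu hUWV hp hd2 hx) hu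
      (by simpa using hu2 0) (by simpa using hu2 1)
    have hmap := congrArg (fun M => M.map (Int.castRingHom (ZMod p))) hUWV
    simp only [Matrix.map_mul, diagonal_map (map_zero (Int.castRingHom (ZMod p)))] at hmap
    refine exists_eq_smul_of_mul_eq_diagonal ?_ hmap (i₀ := ⟨n - 1, by omega⟩)
      (fun i hi h => hd1 i hi ((ZMod.intCast_zmod_eq_zero_iff_dvd _ p).mp h)) hx hy hy0
    have h := hUu.map (Int.castRingHom (ZMod p))
    rwa [RingHom.map_det] at h
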